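/- arXiv:2004.13509 — 3 statements merged into one kernel-verified Lean document; each statement's English description precedes it below -/
import Mathlib

section
/- For every real t there exists an angle θ ∈ ℝ such that all three translated vertices Q₁(t), Q₂(t), Q₃(t) lie on the ellipse centered at X₉(t) obtained by rotating the ellipse with semiaxes a₉(t) (major) and b₉(t) (minor) by θ; explicitly, for each i, writing (wᵢ, zᵢ) = Qᵢ(t) − X₉(t), uᵢ = cos θ·wᵢ + sin θ·zᵢ and vᵢ = −sin θ·wᵢ + cos θ·zᵢ, one has uᵢ²/a₉(t)² + vᵢ²/b₉(t)² = 1, where a₉(t) = L(t)·R·√(3R² + 2dR − d²)/(9R² − d²) and b₉(t) = L(t)·R·√(R − d)/(√(3R + d)·(3R − d)). In particular the ratios a₉(t)/L(t) and b₉(t)/L(t) are constants depending only on R and d, so the circumbilliard of the poristic triangle has invariant aspect ratio. -/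
noncomputable section

/-- Inradius determined by Euler's relation: `r = (R² − d²)/(2R)`. -/
def rIn (R d : ℝ) : ℝ := (R ^ 2 - d ^ 2) / (2 * R)

/-- `ω = √(R² − (d cos t + r)²)`. -/
def om (R d t : ℝ) : ℝ := Real.sqrt (R ^ 2 - (d * Real.cos t + rIn R d) ^ 2)

/-- Vertices `P₁(t), P₂(t), P₃(t)` of the poristic triangle
(circumcircle centered at `X₃ = (d,0)` with radius `R`,
incircle centered at `X₁ = (2d,0)` with radius `r`). -/
def Pv (R d t : ℝ) : Fin 3 → ℝ × ℝ :=
  ![(Real.cos t * (d * Real.cos t + rIn R d) - om R d t * Real.sin t + d,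
     (d * Real.cos t + rIn R d) * Real.sin t + om R d t * Real.cos t),
    (Real.cos t * (d * Real.cos t + rIn R d) + om R d t * Real.sin t + d,
     (d * Real.cos t + rIn R d) * Real.sin t - om R d t * Real.cos t),
    (R * (2 * d * R - (R ^ 2 + d ^ 2) * Real.cos t) /
       (R ^ 2 - 2 * d * R * Real.cos t + d ^ 2) + d,
     R * (d ^ 2 - R ^ 2) * Real.sin t /
       (R ^ 2 - 2 * d * R * Real.cos t + d ^ 2))]

/-- Coefficient of `x` in the excentral sideline `ℓᵢ'(t)`. -/
def lineA (R d t : ℝ) : Fin 3 → ℝ :=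
  ![(d * Real.sin t - om R d t) * Real.sin t - rIn R d * Real.cos t,
    (d * Real.sin t + om R d t) * Real.sin t - rIn R d * Real.cos t,
    R * Real.cos t - d]

/-- Coefficient of `y` in the excentral sideline `ℓᵢ'(t)`. -/
def lineB (R d t : ℝ) : Fin 3 → ℝ :=
  ![-((d * Real.cos t + rIn R d) * Real.sin t - om R d t * Real.cos t),
    -((d * Real.cos t + rIn R d) * Real.sin t + om R d t * Real.cos t),
    R * Real.sin t]

/-- Constant coefficient in the excentral sideline `ℓᵢ'(t)`. -/
def lineC (R d t : ℝ) : Fin 3 → ℝ :=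
  ![R ^ 2 - d ^ 2, R ^ 2 - d ^ 2, -(2 * d * R * Real.cos t) + R ^ 2 + d ^ 2]

/-- Perimeter `L(t)` of the poristic triangle. -/
def Lper (R d t : ℝ) : ℝ :=
  (3 * R ^ 2 - 4 * d * R * Real.cos t + d ^ 2)
    * Real.sqrt (3 * R ^ 2 + 2 * d * R * Real.cos t - d ^ 2)
    / (R * Real.sqrt (R ^ 2 - 2 * d * R * Real.cos t + d ^ 2))

/-- The Mittenpunkt `X₉(t)` (in circumcenter-centered coordinates). -/
def X9 (R d t : ℝ) : ℝ × ℝ :=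
  (d * (4 * d * Real.cos t ^ 2 * (R * Real.cos t - d)
        - rIn R d * (3 * d * Real.cos t + R) - rIn R d ^ 2)
     / ((4 * R + rIn R d) * (d * Real.cos t - R + rIn R d)),
   4 * R * d ^ 2 * Real.sin t * (R ^ 2 - (2 * R * Real.cos t - d) ^ 2)
     / ((R ^ 2 + d ^ 2 - 2 * d * R * Real.cos t) * (9 * R ^ 2 - d ^ 2)))

/-- Translated vertices `Qᵢ(t) = Pᵢ(t) − (d, 0)` (circumcenter at origin). -/
def Qv (R d t : ℝ) (i : Fin 3) : ℝ × ℝ := ((Pv R d t i).1 - d, (Pv R d t i).2)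

/-- Major semiaxis of the circumbilliard. -/
def a9 (R d t : ℝ) : ℝ :=
  Lper R d t * R * Real.sqrt (3 * R ^ 2 + 2 * d * R - d ^ 2) / (9 * R ^ 2 - d ^ 2)

/-- Minor semiaxis of the circumbilliard. -/
def b9 (R d t : ℝ) : ℝ :=
  Lper R d t * R * Real.sqrt (R - d) / (Real.sqrt (3 * R + d) * (3 * R - d))


lemma cb_poly3 (R d c s : ℝ) (hs : s ^ 2 = 1 - c ^ 2) (D K N M G H A B : ℝ)
    (hD : D = R ^ 2 - 2 * d * R * c + d ^ 2) (hK : K = 9 * R ^ 2 - d ^ 2)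
    (hN : N = 3 * R ^ 2 - 4 * d * R * c + d ^ 2)
    (hM : M = 3 * R ^ 2 + 2 * d * R * c - d ^ 2)
    (hG : G = c * ((R * c - d) ^ 2 - R ^ 2 * (1 - c ^ 2)) - 2 * R * (1 - c ^ 2) * (R * c - d))
    (hH : H = ((R * c - d) ^ 2 - R ^ 2 * (1 - c ^ 2)) + 2 * R * c * (R * c - d))
    (hA : A = R * (2 * d * R - (R ^ 2 + d ^ 2) * c) * K
      + d * (16 * R ^ 2 * d * c ^ 2 * (R * c - d) - 2 * R * (R ^ 2 - d ^ 2) * (3 * d * c + R)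
        - (R ^ 2 - d ^ 2) ^ 2))
    (hB : B = R * (d ^ 2 - R ^ 2) * K - 4 * R * d ^ 2 * (R ^ 2 - (2 * R * c - d) ^ 2)) :
    (3 * R ^ 2 - d ^ 2) * D * (A ^ 2 + (s * B) ^ 2)
      - 2 * d * R * (G * (A ^ 2 - (s * B) ^ 2) + 2 * (s * H) * A * (s * B))
      = N ^ 2 * M * (R ^ 2 - d ^ 2) * D ^ 2 * K := by
  have h : (3 * R ^ 2 - d ^ 2) * D * (A ^ 2 + (1 - c ^ 2) * B ^ 2)
      - 2 * d * R * (G * (A ^ 2 - (1 - c ^ 2) * B ^ 2) + 2 * (1 - c ^ 2) * H * A * B)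
      = N ^ 2 * M * (R ^ 2 - d ^ 2) * D ^ 2 * K := by
    subst hA hB; subst hG hH hD hK hN hM; ring
  linear_combination h + ((3 * R ^ 2 - d ^ 2) * B ^ 2 * D + 2 * d * R * G * B ^ 2
    - 4 * d * R * H * A * B) * hs

/- here `P`, `Q` are multiplied by `2R`, and `w = 2R ω`. -/
lemma cb_poly12 (R d c s w : ℝ) (hs : s ^ 2 = 1 - c ^ 2) (D K N M G H P Q : ℝ)
    (hw : w ^ 2 = D * M)
    (hD : D = R ^ 2 - 2 * d * R * c + d ^ 2) (hK : K = 9 * R ^ 2 - d ^ 2)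
    (hN : N = 3 * R ^ 2 - 4 * d * R * c + d ^ 2)
    (hM : M = 3 * R ^ 2 + 2 * d * R * c - d ^ 2)
    (hG : G = c * ((R * c - d) ^ 2 - R ^ 2 * (1 - c ^ 2)) - 2 * R * (1 - c ^ 2) * (R * c - d))
    (hH : H = ((R * c - d) ^ 2 - R ^ 2 * (1 - c ^ 2)) + 2 * R * c * (R * c - d))
    (hP : P = c * (2 * d * R * c + R ^ 2 - d ^ 2) * D * K
      + 2 * R * d * (16 * R ^ 2 * d * c ^ 2 * (R * c - d)
        - 2 * R * (R ^ 2 - d ^ 2) * (3 * d * c + R) - (R ^ 2 - d ^ 2) ^ 2))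
    (hQ : Q = (2 * d * R * c + R ^ 2 - d ^ 2) * D * K
      - 8 * R ^ 2 * d ^ 2 * (R ^ 2 - (2 * R * c - d) ^ 2)) :
    (3 * R ^ 2 - d ^ 2) * D * ((P - w * s * D * K) ^ 2 + (s * Q + w * c * D * K) ^ 2)
      - 2 * d * R * (G * ((P - w * s * D * K) ^ 2 - (s * Q + w * c * D * K) ^ 2)
        + 2 * (s * H) * (P - w * s * D * K) * (s * Q + w * c * D * K))
      = 4 * R ^ 2 * (N ^ 2 * M * (R ^ 2 - d ^ 2) * D ^ 2 * K) := by
  have h0 : (3 * R ^ 2 - d ^ 2) * D * (-P + c * Q)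
      - 2 * d * R * (G * (-P - c * Q) + H * (P * c - (1 - c ^ 2) * Q)) = 0 := by
    subst hP hQ; subst hG hH hD hK hN hM; ring
  have h1 : (3 * R ^ 2 - d ^ 2) * D * (P ^ 2 + D * M * D ^ 2 * K ^ 2 + (1 - c ^ 2) * Q ^ 2)
      - 2 * d * R * (G * (P ^ 2 + D * M * (1 - c ^ 2) * D ^ 2 * K ^ 2 - (1 - c ^ 2) * Q ^ 2
        - D * M * c ^ 2 * D ^ 2 * K ^ 2)
        + 2 * (1 - c ^ 2) * H * (P * Q - D * M * c * D ^ 2 * K ^ 2))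
      = 4 * R ^ 2 * (N ^ 2 * M * (R ^ 2 - d ^ 2) * D ^ 2 * K) := by
    clear hw h0
    subst hP hQ; subst hG hH hD hK hN hM; ring
  clear hP hQ hG hH hD hK hN hM
  have e : (3 * R ^ 2 - d ^ 2) * D * ((P - w * s * D * K) ^ 2 + (s * Q + w * c * D * K) ^ 2)
      - 2 * d * R * (G * ((P - w * s * D * K) ^ 2 - (s * Q + w * c * D * K) ^ 2)
        + 2 * (s * H) * (P - w * s * D * K) * (s * Q + w * c * D * K))
      = (3 * R ^ 2 - d ^ 2) * D * (P ^ 2 + w ^ 2 * (s ^ 2 + c ^ 2) * D ^ 2 * K ^ 2 + s ^ 2 * Q ^ 2)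
      - 2 * d * R * (G * (P ^ 2 + w ^ 2 * s ^ 2 * D ^ 2 * K ^ 2 - s ^ 2 * Q ^ 2
        - w ^ 2 * c ^ 2 * D ^ 2 * K ^ 2)
        + 2 * s ^ 2 * H * (P * Q - w ^ 2 * c * D ^ 2 * K ^ 2))
      + 2 * w * s * D * K * ((3 * R ^ 2 - d ^ 2) * D * (-P + c * Q)
      - 2 * d * R * (G * (-P - c * Q) + H * (P * c - s ^ 2 * Q))) := by ring
  rw [e, hs, hw, h0, ← h1]; ring

lemma cb_reduce (R d a2 b2 C S D K N M cθ sθ x y : ℝ) (hR : R ^ 2 - d ^ 2 ≠ 0)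
    (h1 : 3 * R + d ≠ 0) (h2 : 3 * R - d ≠ 0) (h3 : R + d ≠ 0) (h4 : R - d ≠ 0)
    (hN : N ≠ 0) (hM : M ≠ 0) (hD : D ≠ 0) (hK : K = (3 * R + d) * (3 * R - d))
    (ha : a2 = N ^ 2 * M * (R + d) / (D * (3 * R - d) * (3 * R + d) ^ 2))
    (hb : b2 = N ^ 2 * M * (R - d) / (D * (3 * R + d) * (3 * R - d) ^ 2))
    (hC : C = cθ ^ 2 - sθ ^ 2) (hS : S = 2 * sθ * cθ) (h : cθ ^ 2 + sθ ^ 2 = 1)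
    (key : (3 * R ^ 2 - d ^ 2) * (x ^ 2 + y ^ 2) - 2 * d * R * (C * (x ^ 2 - y ^ 2) + 2 * S * x * y)
      = N ^ 2 * M * (R ^ 2 - d ^ 2) / (D * K)) :
    (cθ * x + sθ * y) ^ 2 / a2 + (-sθ * x + cθ * y) ^ 2 / b2 = 1 := by
  have e1 : (cθ * x + sθ * y) ^ 2 / a2 + (-sθ * x + cθ * y) ^ 2 / b2
     = ((R - d) * (3 * R + d) * (cθ * x + sθ * y) ^ 2
        + (R + d) * (3 * R - d) * (-sθ * x + cθ * y) ^ 2) *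
        (D * K / (N ^ 2 * M * (R ^ 2 - d ^ 2))) := by
    have : R ^ 2 - d ^ 2 = (R + d) * (R - d) := by ring
    rw [ha, hb, hK, this]; field_simp
  have e2 : ((R - d) * (3 * R + d) * (cθ * x + sθ * y) ^ 2
        + (R + d) * (3 * R - d) * (-sθ * x + cθ * y) ^ 2)
      = N ^ 2 * M * (R ^ 2 - d ^ 2) / (D * K) := by
    rw [← key, hC, hS]
    linear_combination (3 * R ^ 2 - d ^ 2) * (x ^ 2 + y ^ 2) * h
  have hK0 : K ≠ 0 := by rw [hK]; positivity
  rw [e1, e2]; field_simp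

lemma cb_sqrt_sq (R d t : ℝ) (hd : 0 < d) (hdR : d < R) :
    0 < R ^ 2 - 2 * d * R * Real.cos t + d ^ 2 ∧
    0 < 3 * R ^ 2 - 4 * d * R * Real.cos t + d ^ 2 ∧
    0 < 3 * R ^ 2 + 2 * d * R * Real.cos t - d ^ 2 := by
  have h1 := Real.cos_le_one t
  have h2 := Real.neg_one_le_cos t
  have h3 : 0 < d * R := by nlinarith
  have h4 : d * R * Real.cos t ≤ d * R := by nlinarith
  have h5 : -(d * R) ≤ d * R * Real.cos t := by nlinarith
  refine ⟨by nlinarith [sq_pos_of_pos (sub_pos.2 hdR)], by nlinarith, by nlinarith⟩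

/-- the translated poristic vertices `Qᵢ(t)` lie on an ellipse
centered at `X₉(t)` obtained by rotating the ellipse with semiaxes
`a₉(t)` (major) and `b₉(t)` (minor) by some angle `θ`; since `a₉(t)/L(t)` and
`b₉(t)/L(t)` depend only on `R,d`, the circumbilliard has invariant aspect ratio. -/
theorem circumbilliard_invariant_axes (R d : ℝ) (hd : 0 < d) (hdR : d < R) (t : ℝ) :
    ∃ θ : ℝ, ∀ i : Fin 3,
      (Real.cos θ * ((Qv R d t i).1 - (X9 R d t).1)
          + Real.sin θ * ((Qv R d t i).2 - (X9 R d t).2)) ^ 2 / a9 R d t ^ 2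
        + (-Real.sin θ * ((Qv R d t i).1 - (X9 R d t).1)
            + Real.cos θ * ((Qv R d t i).2 - (X9 R d t).2)) ^ 2 / b9 R d t ^ 2 = 1 := by
  have hR : 0 < R := hd.trans hdR
  obtain ⟨pD, pN, pM⟩ := cb_sqrt_sq R d t hd hdR
  have hs : Real.sin t ^ 2 = 1 - Real.cos t ^ 2 := Real.sin_sq t
  have p1 : 0 < 3 * R + d := by linarith
  have p2 : 0 < 3 * R - d := by linarith
  have p3 : 0 < R + d := by linarith
  have p4 : 0 < R - d := by linarith
  have p5 : 0 < R ^ 2 - d ^ 2 := by nlinarith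
  have pK : 0 < 9 * R ^ 2 - d ^ 2 := by nlinarith
  have ha : a9 R d t ^ 2 = (3 * R ^ 2 - 4 * d * R * Real.cos t + d ^ 2) ^ 2
      * (3 * R ^ 2 + 2 * d * R * Real.cos t - d ^ 2) * (R + d)
      / ((R ^ 2 - 2 * d * R * Real.cos t + d ^ 2) * (3 * R - d) * (3 * R + d) ^ 2) := by
    unfold a9 Lper
    have q : 3 * R ^ 2 + 2 * d * R - d ^ 2 = (3 * R - d) * (R + d) := by ring
    have q' : 9 * R ^ 2 - d ^ 2 = (3 * R - d) * (3 * R + d) := by ring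
    simp only [div_pow, mul_pow]
    rw [Real.sq_sqrt pM.le, Real.sq_sqrt pD.le, q, Real.sq_sqrt (by positivity), q']
    field_simp
  have hb : b9 R d t ^ 2 = (3 * R ^ 2 - 4 * d * R * Real.cos t + d ^ 2) ^ 2
      * (3 * R ^ 2 + 2 * d * R * Real.cos t - d ^ 2) * (R - d)
      / ((R ^ 2 - 2 * d * R * Real.cos t + d ^ 2) * (3 * R + d) * (3 * R - d) ^ 2) := by
    unfold b9 Lper
    simp only [div_pow, mul_pow]
    rw [Real.sq_sqrt pM.le, Real.sq_sqrt pD.le, Real.sq_sqrt p4.le, Real.sq_sqrt p1.le]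
    field_simp
  have hw : (2 * R * om R d t) ^ 2 = (R ^ 2 - 2 * d * R * Real.cos t + d ^ 2)
      * (3 * R ^ 2 + 2 * d * R * Real.cos t - d ^ 2) := by
    have q : R ^ 2 - (d * Real.cos t + rIn R d) ^ 2 = (R ^ 2 - 2 * d * R * Real.cos t + d ^ 2)
      * (3 * R ^ 2 + 2 * d * R * Real.cos t - d ^ 2) / (2 * R) ^ 2 := by
      unfold rIn; field_simp; ring
    unfold om
    rw [mul_pow, q, Real.sq_sqrt (by positivity)]
    field_simp
  have hX1 : (X9 R d t).1 = -(d * (16 * R ^ 2 * d * Real.cos t ^ 2 * (R * Real.cos t - d)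
      - 2 * R * (R ^ 2 - d ^ 2) * (3 * d * Real.cos t + R) - (R ^ 2 - d ^ 2) ^ 2))
      / ((R ^ 2 - 2 * d * R * Real.cos t + d ^ 2) * (9 * R ^ 2 - d ^ 2)) := by
    have q1 : 4 * R + rIn R d = (9 * R ^ 2 - d ^ 2) / (2 * R) := by
      unfold rIn; field_simp; ring
    have q2 : d * Real.cos t - R + rIn R d
        = -(R ^ 2 - 2 * d * R * Real.cos t + d ^ 2) / (2 * R) := by
      unfold rIn; field_simp; ring
    simp only [X9]
    rw [q1, q2]
    have q3 : rIn R d = (R ^ 2 - d ^ 2) / (2 * R) := rfl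
    rw [q3]
    have := pD.ne'
    have := pK.ne'
    generalize R ^ 2 - 2 * d * R * Real.cos t + d ^ 2 = D at *
    generalize 9 * R ^ 2 - d ^ 2 = K at *
    field_simp
    ring
  have hX2 : (X9 R d t).2 = Real.sin t * (4 * R * d ^ 2 * (R ^ 2 - (2 * R * Real.cos t - d) ^ 2))
      / ((R ^ 2 - 2 * d * R * Real.cos t + d ^ 2) * (9 * R ^ 2 - d ^ 2)) := by
    simp only [X9]
    rw [show R ^ 2 + d ^ 2 - 2 * d * R * Real.cos t
      = R ^ 2 - 2 * d * R * Real.cos t + d ^ 2 by ring]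
    ring
  have hQ : ∀ i, Qv R d t i = ![
      (Real.cos t * ((2 * d * R * Real.cos t + R ^ 2 - d ^ 2) / (2 * R))
        - om R d t * Real.sin t,
       (2 * d * R * Real.cos t + R ^ 2 - d ^ 2) / (2 * R) * Real.sin t
        + om R d t * Real.cos t),
      (Real.cos t * ((2 * d * R * Real.cos t + R ^ 2 - d ^ 2) / (2 * R))
        - (- om R d t) * Real.sin t,
       (2 * d * R * Real.cos t + R ^ 2 - d ^ 2) / (2 * R) * Real.sin t
        + (- om R d t) * Real.cos t),
      (R * (2 * d * R - (R ^ 2 + d ^ 2) * Real.cos t) /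
       (R ^ 2 - 2 * d * R * Real.cos t + d ^ 2),
     R * (d ^ 2 - R ^ 2) * Real.sin t /
       (R ^ 2 - 2 * d * R * Real.cos t + d ^ 2))] i := by
    have q : (2 * d * R * Real.cos t + R ^ 2 - d ^ 2) / (2 * R)
        = d * Real.cos t + rIn R d := by
      unfold rIn; field_simp; ring
    rw [q]
    intro i
    fin_cases i <;> simp [Qv, Pv, sub_eq_add_neg]
  -- the angle
  obtain ⟨G, hG⟩ : ∃ G, G = Real.cos t * ((R * Real.cos t - d) ^ 2
    - R ^ 2 * (1 - Real.cos t ^ 2)) - 2 * R * (1 - Real.cos t ^ 2) * (R * Real.cos t - d) :=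
    ⟨_, rfl⟩
  obtain ⟨H, hH⟩ : ∃ H, H = ((R * Real.cos t - d) ^ 2 - R ^ 2 * (1 - Real.cos t ^ 2))
    + 2 * R * Real.cos t * (R * Real.cos t - d) := ⟨_, rfl⟩
  have P3 := fun A B => cb_poly3 R d (Real.cos t) (Real.sin t) hs _ _ _ _ G H A B rfl rfl rfl rfl
    hG hH
  have P12 := fun w P Q hw => cb_poly12 R d (Real.cos t) (Real.sin t) w hs _ _ _ _ G H P Q
    hw rfl rfl rfl rfl hG hH
  have hGH : G ^ 2 + (Real.sin t * H) ^ 2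
      = (R ^ 2 - 2 * d * R * Real.cos t + d ^ 2) ^ 2 := by
    rw [mul_pow, hs, hG, hH]; ring
  have hKf : 9 * R ^ 2 - d ^ 2 = (3 * R + d) * (3 * R - d) := by ring
  have red := fun C S cθ sθ x y => cb_reduce R d _ _ C S _ _ _ _ cθ sθ x y p5.ne' p1.ne' p2.ne'
    p3.ne' p4.ne' pN.ne' pM.ne' pD.ne' hKf ha hb
  clear ha hb hG hH
  generalize R ^ 2 - 2 * d * R * Real.cos t + d ^ 2 = D at *
  generalize 3 * R ^ 2 + 2 * d * R * Real.cos t - d ^ 2 = M at *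
  generalize 3 * R ^ 2 - 4 * d * R * Real.cos t + d ^ 2 = N at *
  clear hKf
  generalize 9 * R ^ 2 - d ^ 2 = K at *
  obtain ⟨θ, hC, hS⟩ : ∃ θ, G / D = Real.cos θ ^ 2 - Real.sin θ ^ 2 ∧
      Real.sin t * H / D = 2 * Real.sin θ * Real.cos θ := by
    have hn : ‖(⟨G / D, Real.sin t * H / D⟩ : ℂ)‖ = 1 := by
      have : ‖(⟨G / D, Real.sin t * H / D⟩ : ℂ)‖ ^ 2 = 1 := by
        rw [Complex.sq_norm, Complex.normSq_mk]
        field_simp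
        linarith
      exact (pow_eq_one_iff_of_nonneg (norm_nonneg _) two_ne_zero).1 this
    have hne : (⟨G / D, Real.sin t * H / D⟩ : ℂ) ≠ 0 := by
      intro h; rw [h] at hn; simp at hn
    refine ⟨Complex.arg ⟨G / D, Real.sin t * H / D⟩ / 2, ?_, ?_⟩
    · rw [← Real.cos_two_mul', mul_div_cancel₀ _ two_ne_zero, Complex.cos_arg hne, hn]; simp
    · rw [← Real.sin_two_mul, mul_div_cancel₀ _ two_ne_zero, Complex.sin_arg, hn]; simp
  have V12 : ∀ o : ℝ, (2 * R * o) ^ 2 = D * M →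
      (3 * R ^ 2 - d ^ 2) * ((Real.cos t * ((2 * d * R * Real.cos t + R ^ 2 - d ^ 2) / (2 * R))
        - o * Real.sin t - (X9 R d t).1) ^ 2 +
       ((2 * d * R * Real.cos t + R ^ 2 - d ^ 2) / (2 * R) * Real.sin t
        + o * Real.cos t - (X9 R d t).2) ^ 2) - 2 * d * R * (G / D *
       ((Real.cos t * ((2 * d * R * Real.cos t + R ^ 2 - d ^ 2) / (2 * R))
        - o * Real.sin t - (X9 R d t).1) ^ 2 -
       ((2 * d * R * Real.cos t + R ^ 2 - d ^ 2) / (2 * R) * Real.sin t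
        + o * Real.cos t - (X9 R d t).2) ^ 2) + 2 * (Real.sin t * H / D) *
       (Real.cos t * ((2 * d * R * Real.cos t + R ^ 2 - d ^ 2) / (2 * R))
        - o * Real.sin t - (X9 R d t).1) *
       ((2 * d * R * Real.cos t + R ^ 2 - d ^ 2) / (2 * R) * Real.sin t
        + o * Real.cos t - (X9 R d t).2)) = N ^ 2 * M * (R ^ 2 - d ^ 2) / (D * K) := by
    intro o ho
    have k := P12 (2 * R * o) _ _ ho rfl rfl
    have g1 : Real.cos t * ((2 * d * R * Real.cos t + R ^ 2 - d ^ 2) / (2 * R))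
        - o * Real.sin t - (X9 R d t).1 = ((Real.cos t * (2 * d * R * Real.cos t + R ^ 2 - d ^ 2)
        * D * K + 2 * R * d * (16 * R ^ 2 * d * Real.cos t ^ 2 * (R * Real.cos t - d)
        - 2 * R * (R ^ 2 - d ^ 2) * (3 * d * Real.cos t + R) - (R ^ 2 - d ^ 2) ^ 2))
        - 2 * R * o * Real.sin t * D * K) / (2 * R * D * K) := by
      rw [hX1]; field_simp; ring
    have g2 : (2 * d * R * Real.cos t + R ^ 2 - d ^ 2) / (2 * R) * Real.sin t
        + o * Real.cos t - (X9 R d t).2 = (Real.sin t * ((2 * d * R * Real.cos t + R ^ 2 - d ^ 2)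
        * D * K - 8 * R ^ 2 * d ^ 2 * (R ^ 2 - (2 * R * Real.cos t - d) ^ 2))
        + 2 * R * o * Real.cos t * D * K) / (2 * R * D * K) := by
      rw [hX2]; field_simp; ring
    rw [g1, g2]
    clear g1 g2 P12 P3 red hX1 hX2 hQ
    generalize (Real.cos t * (2 * d * R * Real.cos t + R ^ 2 - d ^ 2)
        * D * K + 2 * R * d * (16 * R ^ 2 * d * Real.cos t ^ 2 * (R * Real.cos t - d)
        - 2 * R * (R ^ 2 - d ^ 2) * (3 * d * Real.cos t + R) - (R ^ 2 - d ^ 2) ^ 2))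
        - 2 * R * o * Real.sin t * D * K = U at *
    generalize Real.sin t * ((2 * d * R * Real.cos t + R ^ 2 - d ^ 2)
        * D * K - 8 * R ^ 2 * d ^ 2 * (R ^ 2 - (2 * R * Real.cos t - d) ^ 2))
        + 2 * R * o * Real.cos t * D * K = V at *
    generalize Real.sin t * H = H' at *
    rw [eq_div_iff (by positivity)]
    have e : N ^ 2 * M * (R ^ 2 - d ^ 2)
      = (4 * R ^ 2 * (N ^ 2 * M * (R ^ 2 - d ^ 2) * D ^ 2 * K)) / (4 * R ^ 2 * D ^ 2 * K) := by
      field_simp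
    rw [e, ← k]
    generalize 3 * R ^ 2 - d ^ 2 = Z at *
    field_simp
    ring
  have V3 : (3 * R ^ 2 - d ^ 2) * ((R * (2 * d * R - (R ^ 2 + d ^ 2) * Real.cos t) / D
        - (X9 R d t).1) ^ 2 + (R * (d ^ 2 - R ^ 2) * Real.sin t / D - (X9 R d t).2) ^ 2)
       - 2 * d * R * (G / D * ((R * (2 * d * R - (R ^ 2 + d ^ 2) * Real.cos t) / D
        - (X9 R d t).1) ^ 2 - (R * (d ^ 2 - R ^ 2) * Real.sin t / D - (X9 R d t).2) ^ 2)
        + 2 * (Real.sin t * H / D) * (R * (2 * d * R - (R ^ 2 + d ^ 2) * Real.cos t) / D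
        - (X9 R d t).1) * (R * (d ^ 2 - R ^ 2) * Real.sin t / D - (X9 R d t).2))
        = N ^ 2 * M * (R ^ 2 - d ^ 2) / (D * K) := by
    have k := P3 _ _ rfl rfl
    have g1 : R * (2 * d * R - (R ^ 2 + d ^ 2) * Real.cos t) / D - (X9 R d t).1
       = (R * (2 * d * R - (R ^ 2 + d ^ 2) * Real.cos t) * K
      + d * (16 * R ^ 2 * d * Real.cos t ^ 2 * (R * Real.cos t - d)
        - 2 * R * (R ^ 2 - d ^ 2) * (3 * d * Real.cos t + R)
        - (R ^ 2 - d ^ 2) ^ 2)) / (D * K) := by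
      rw [hX1]; field_simp; ring
    have g2 : R * (d ^ 2 - R ^ 2) * Real.sin t / D - (X9 R d t).2
       = (Real.sin t * (R * (d ^ 2 - R ^ 2) * K
        - 4 * R * d ^ 2 * (R ^ 2 - (2 * R * Real.cos t - d) ^ 2))) / (D * K) := by
      rw [hX2]; field_simp
    rw [g1, g2]
    clear g1 g2 P12 P3 red hX1 hX2 hQ V12
    generalize R * (2 * d * R - (R ^ 2 + d ^ 2) * Real.cos t) * K
      + d * (16 * R ^ 2 * d * Real.cos t ^ 2 * (R * Real.cos t - d)
        - 2 * R * (R ^ 2 - d ^ 2) * (3 * d * Real.cos t + R)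
        - (R ^ 2 - d ^ 2) ^ 2) = U at *
    generalize Real.sin t * (R * (d ^ 2 - R ^ 2) * K
        - 4 * R * d ^ 2 * (R ^ 2 - (2 * R * Real.cos t - d) ^ 2)) = V at *
    generalize Real.sin t * H = H' at *
    rw [eq_div_iff (by positivity)]
    have e : N ^ 2 * M * (R ^ 2 - d ^ 2)
      = (N ^ 2 * M * (R ^ 2 - d ^ 2) * D ^ 2 * K) / (D ^ 2 * K) := by
      field_simp
    rw [e, ← k]
    generalize 3 * R ^ 2 - d ^ 2 = Z at *
    field_simp
  refine ⟨θ, fun i => red _ _ _ _ _ _ hC hS (Real.cos_sq_add_sin_sq θ) ?_⟩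
  rw [hQ]
  fin_cases i
  · exact V12 (om R d t) hw
  · exact V12 (-om R d t) (by rw [← hw]; ring)
  · exact V3
end
end

section
/- For every real t for which P₁(t), P₂(t), P₃(t) are not collinear, let S(t) be the incenter of the medial triangle of P₁(t)P₂(t)P₃(t), i.e. of the triangle with vertices (P₂(t) + P₃(t))/2, (P₁(t) + P₃(t))/2, (P₁(t) + P₂(t))/2 (S(t) is the Spieker center X₁₀). Then there exist an angle θ ∈ ℝ and semiaxes η > ζ > 0 with η/ζ = √((R + d)/(R − d)) such that all three vertices Pᵢ(t) lie on the ellipse centered at S(t) obtained by rotating {(u, v) : u²/η² + v²/ζ² = 1} by θ. (Thus the circumconic centered at the Spieker point has invariant aspect ratio √((R + d)/(R − d)).) -/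
noncomputable section

/-- Euclidean norm on `ℝ²`. -/
def ptNorm (p : ℝ × ℝ) : ℝ := Real.sqrt (p.1 ^ 2 + p.2 ^ 2)

/-- Vertices of the medial triangle of the poristic triangle:
`Mᵢ = (Pⱼ + Pₖ)/2` for `{j,k} = {1,2,3} \ {i}`. -/
def Mv (R d t : ℝ) : Fin 3 → ℝ × ℝ :=
  ![(2⁻¹ : ℝ) • (Pv R d t 1 + Pv R d t 2),
    (2⁻¹ : ℝ) • (Pv R d t 0 + Pv R d t 2),
    (2⁻¹ : ℝ) • (Pv R d t 0 + Pv R d t 1)]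

/-- The Spieker center `X₁₀`: the incenter of the medial triangle, given by the
barycentric formula with weights the sidelengths of the medial triangle. -/
def Spieker (R d t : ℝ) : ℝ × ℝ :=
  (ptNorm (Mv R d t 1 - Mv R d t 2) + ptNorm (Mv R d t 0 - Mv R d t 2)
      + ptNorm (Mv R d t 0 - Mv R d t 1))⁻¹ •
    (ptNorm (Mv R d t 1 - Mv R d t 2) • Mv R d t 0
      + ptNorm (Mv R d t 0 - Mv R d t 2) • Mv R d t 1
      + ptNorm (Mv R d t 0 - Mv R d t 1) • Mv R d t 2)

theorem len13 (R d c s w r z X Y D : ℝ) (hr : 2*R*r = R^2-d^2) (hcs : s^2 = 1 - c^2)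
  (hw : w^2 = R^2-(d*c+r)^2) (hD : D = R^2-2*d*R*c+d^2) (hD0 : D ≠ 0) (hR : R ≠ 0)
  (hX : X = (2*d*R-(R^2+d^2)*c)/D) (hY : Y = (d^2-R^2)*s/D) (hz : z = (R^2-d^2)*w/D) :
  (c*(d*c+r)-w*s - R*X)^2 + ((d*c+r)*s+w*c - R*Y)^2 = (w + d*s + z)^2 := by
  have hr' : r = (R^2-d^2)/(2*R) := by field_simp; linarith
  subst hX hY hz
  field_simp
  grind
theorem incx (R d c s w r z X Y D : ℝ) (hr : 2*R*r = R^2-d^2) (hcs : s^2 = 1 - c^2)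
  (hw : w^2 = R^2-(d*c+r)^2) (hD : D = R^2-2*d*R*c+d^2) (hD0 : D ≠ 0) (hR : R ≠ 0)
  (hX : X = (2*d*R-(R^2+d^2)*c)/D) (hY : Y = (d^2-R^2)*s/D) (hz : z = (R^2-d^2)*w/D) :
  (w-d*s+z)*(c*(d*c+r)-w*s) + (w+d*s+z)*(c*(d*c+r)+w*s) + 2*w*(R*X) = (4*w+2*z)*d := by
  subst hX hY hz
  field_simp
  grind
theorem incy (R d c s w r z X Y D : ℝ) (hr : 2*R*r = R^2-d^2) (hcs : s^2 = 1 - c^2)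
  (hw : w^2 = R^2-(d*c+r)^2) (hD : D = R^2-2*d*R*c+d^2) (hD0 : D ≠ 0) (hR : R ≠ 0)
  (hX : X = (2*d*R-(R^2+d^2)*c)/D) (hY : Y = (d^2-R^2)*s/D) (hz : z = (R^2-d^2)*w/D) :
  (w-d*s+z)*((d*c+r)*s+w*c) + (w+d*s+z)*((d*c+r)*s-w*c) + 2*w*(R*Y) = 0 := by
  subst hX hY hz
  field_simp
  grind
theorem xy1 (R d c s X Y D : ℝ) (hcs : s^2 = 1 - c^2)
   (hD : D = R^2-2*d*R*c+d^2) (hD0 : D ≠ 0) 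
  (hX : X = (2*d*R-(R^2+d^2)*c)/D) (hY : Y = (d^2-R^2)*s/D) : X^2+Y^2=1 := by
  subst hX hY
  field_simp
  grind
theorem e12 (R d c s X Y D C S : ℝ) (hcs : s^2 = 1 - c^2)
   (hD : D = R^2-2*d*R*c+d^2) (hD0 : D ≠ 0) 
  (hX : X = (2*d*R-(R^2+d^2)*c)/D) (hY : Y = (d^2-R^2)*s/D) 
  (hC : C = -((c^2-s^2)*X-2*c*s*Y)) (hS : S = -((c^2-s^2)*Y+2*c*s*X)):
  R*(-s*(d-R*X)+c*(-R*Y)) - d*(C*(-s*(d-R*X)-c*(-R*Y))+S*(-s*(-R*Y)+c*(d-R*X)))=0 := by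
  have h1 := xy1 R d c s X Y D hcs hD hD0 hX hY
  subst hC hS
  have hX : D*X = (2*d*R-(R^2+d^2)*c) := by rw [hX]; field_simp
  have hY : D*Y = (d^2-R^2)*s := by rw [hY]; field_simp
  apply mul_left_cancel₀ hD0
  grind
theorem e13a (R d c s w r X Y D A B: ℝ) (hr : 2*R*r = R^2-d^2) (hcs : s^2 = 1 - c^2)
  (hw : w^2 = R^2-(d*c+r)^2) (hD : D = R^2-2*d*R*c+d^2) (hD0 : D ≠ 0) (hR : R ≠ 0)
  (hX : X = (2*d*R-(R^2+d^2)*c)/D) (hY : Y = (d^2-R^2)*s/D)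
  (hA : A = c*X+s*Y) (hB : B = c*Y-s*X) (x y x' y' : ℝ)
  (hx : x = d*c+r - R*A) (hy : y = w - R*B)
  (hx' : x' = -r) (hy' : y' = w - d*s) :
  R*(x*x'+y*y') + d*(X*(x*x'-y*y')+Y*(x*y'+y*x'))=0 := by
  have hr' : r = (R^2-d^2)/(2*R) := by field_simp; linarith
  have h0 : R*((d*c+r-R*A)*(-r) + w^2 + R*B*d*s) + d*(X*((d*c+r-R*A)*(-r) - w^2 - R*B*d*s)
     + Y*(-(d*c+r-R*A)*(d*s) + R*B*r)) = 0 := by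
    rw [hw]; clear hw hy hy' hx hx' hr
    subst hA hB hX hY hr'
    field_simp
    subst hD
    clear hD0 hR
    grind
  have h1 : R*(-d*s - R*B) + d*(X*(d*s+R*B)+Y*(d*c+r-R*A - r)) = 0 := by
    clear h0 hw hy hy' hx hx' hr
    subst hA hB hX hY hr'
    field_simp
    subst hD
    clear hD0 hR
    grind
  subst hx hx' hy hy'
  linear_combination h0 + w*h1
theorem e13 (R d c s w r X Y D C S : ℝ) (hr : 2*R*r = R^2-d^2) (hcs : s^2 = 1 - c^2)
  (hw : w^2 = R^2-(d*c+r)^2) (hD : D = R^2-2*d*R*c+d^2) (hD0 : D ≠ 0) (hR : R ≠ 0)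
  (hX : X = (2*d*R-(R^2+d^2)*c)/D) (hY : Y = (d^2-R^2)*s/D)
  (hC : C = -((c^2-s^2)*X-2*c*s*Y)) (hS : S = -((c^2-s^2)*Y+2*c*s*X)) (x y x' y' : ℝ)
  (hx : x = c*(d*c+r)-w*s - R*X) (hy : y = (d*c+r)*s+w*c - R*Y)
  (hx' : x' = d - (c*(d*c+r)+w*s)) (hy' : y' = -((d*c+r)*s-w*c)) :
  R*(x*x'+y*y') - d*(C*(x*x'-y*y')+S*(x*y'+y*x'))=0 := by
  have h := e13a R d c s w r X Y D _ _ hr hcs hw hD hD0 hR hX hY rfl rfl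
     (c*x+s*y) (c*y-s*x) (c*x'+s*y') (c*y'-s*x')
     (by subst hx hy; linear_combination (d*c+r)*hcs) (by subst hx hy; linear_combination (w)*hcs)
     (by subst hx' hy'; linear_combination (-d*c-r)*hcs) (by subst hx' hy'; linear_combination (w)*hcs)
  subst hC hS
  linear_combination h - R*(x*x'+y*y')*hcs

theorem core (R d x1 y1 x2 y2 x3 y3 sx sy C S : ℝ) (hd : 0 < d) (hdR : d < R)
   (hCS : C^2+S^2 = 1)
   (hnc : (x2-x1)*(y3-y1)-(y2-y1)*(x3-x1) ≠ 0)
   (hsx : sx = (x1+x2+x3-2*d)/2) (hsy : sy = (y1+y2+y3)/2)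
   (h12 : R*((x1-x2)*(2*d-x3)+(y1-y2)*(-y3))
      - d*(C*((x1-x2)*(2*d-x3)-(y1-y2)*(-y3))+S*((x1-x2)*(-y3)+(y1-y2)*(2*d-x3)))=0)
   (h13 : R*((x1-x3)*(2*d-x2)+(y1-y3)*(-y2))
      - d*(C*((x1-x3)*(2*d-x2)-(y1-y3)*(-y2))+S*((x1-x3)*(-y2)+(y1-y3)*(2*d-x2)))=0) :
   ∃ θ η ζ : ℝ, 0 < ζ ∧ ζ < η ∧ η / ζ = Real.sqrt ((R + d) / (R - d)) ∧
     ∀ x y, (x = x1 ∧ y = y1 ∨ x = x2 ∧ y = y2 ∨ x = x3 ∧ y = y3) →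
        (Real.cos θ * (x - sx) + Real.sin θ * (y - sy)) ^ 2 / η ^ 2
          + (-Real.sin θ * (x - sx) + Real.cos θ * (y - sy)) ^ 2 / ζ ^ 2 = 1 := by
  obtain ⟨θ, hC, hS⟩ : ∃ θ : ℝ, C = Real.cos θ ^ 2 - Real.sin θ ^ 2 ∧
      S = 2 * Real.sin θ * Real.cos θ := by
    have hn : ‖(⟨C, S⟩ : ℂ)‖ = 1 := by
      rw [Complex.norm_def, Complex.normSq_mk, show C*C+S*S = 1 by linarith, Real.sqrt_one]
    refine ⟨Complex.arg ⟨C, S⟩ / 2, ?_, ?_⟩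
    · rw [← Real.cos_two_mul', mul_div_cancel₀ _ (two_ne_zero)]
      have := Complex.norm_mul_cos_arg ⟨C, S⟩
      rw [hn] at this; simpa using this.symm
    · rw [← Real.sin_two_mul, mul_div_cancel₀ _ (two_ne_zero)]
      have := Complex.norm_mul_sin_arg ⟨C, S⟩
      rw [hn] at this; simpa using this.symm
  have h1 := Real.sin_sq_add_cos_sq θ
  set a := Real.cos θ
  set b := Real.sin θ
  have hQ : ∀ x y : ℝ, (R-d)*(a*x+b*y)^2 + (R+d)*(-b*x+a*y)^2
      = R*(x^2+y^2) - d*(C*(x^2-y^2)+2*S*x*y) := by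
    intro x y; rw [hC, hS]; linear_combination (R*(x^2+y^2))*h1
  obtain ⟨k, hk⟩ : ∃ k, k = (R-d)*(a*(x1-sx)+b*(y1-sy))^2 + (R+d)*(-b*(x1-sx)+a*(y1-sy))^2 := ⟨_, rfl⟩
  have hk2 : k = (R-d)*(a*(x2-sx)+b*(y2-sy))^2 + (R+d)*(-b*(x2-sx)+a*(y2-sy))^2 := by
    rw [hk, hQ, hQ, hsx, hsy]; linear_combination h12
  have hk3 : k = (R-d)*(a*(x3-sx)+b*(y3-sy))^2 + (R+d)*(-b*(x3-sx)+a*(y3-sy))^2 := by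
    rw [hk, hQ, hQ, hsx, hsy]; linear_combination h13
  have hm : 0 < R - d := by linarith
  have hp : 0 < R + d := by linarith
  have hk0 : 0 < k := by
    have hge : 0 ≤ k := by rw [hk]; positivity
    refine lt_of_le_of_ne hge fun h0 => hnc ?_
    have hz : ∀ x y : ℝ, 0 = (R-d)*(a*x+b*y)^2 + (R+d)*(-b*x+a*y)^2 → x = 0 ∧ y = 0 := by
      intro x y h
      have e1 : (R-d)*(a*x+b*y)^2 = 0 := by
        have q1 : 0 ≤ (R-d)*(a*x+b*y)^2 := mul_nonneg hm.le (sq_nonneg _)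
        have q2 : 0 ≤ (R+d)*(-b*x+a*y)^2 := mul_nonneg hp.le (sq_nonneg _)
        clear hQ hk hk2 hk3 h12 h13 hnc
        generalize (R-d)*(a*x+b*y)^2 = u at *
        generalize (R+d)*(-b*x+a*y)^2 = v at *
        linarith
      have e2 : (R+d)*(-b*x+a*y)^2 = 0 := by rw [e1, zero_add] at h; exact h.symm
      have e1' : a*x+b*y = 0 := by simpa [hm.ne'] using e1
      have e2' : -b*x+a*y = 0 := by
        rcases mul_eq_zero.1 e2 with h | h
        · exact absurd h hp.ne'
        · exact pow_eq_zero_iff (two_ne_zero) |>.1 h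
      constructor
      · linear_combination a*e1' - b*e2' - x*h1
      · linear_combination b*e1' + a*e2' - y*h1
    obtain ⟨u1, v1⟩ := hz _ _ (h0.trans hk)
    obtain ⟨u2, v2⟩ := hz _ _ (h0.trans hk2)
    rw [show x2 - x1 = 0 by linarith, show y2 - y1 = 0 by linarith]; ring
  refine ⟨θ, Real.sqrt (k/(R-d)), Real.sqrt (k/(R+d)), Real.sqrt_pos.2 (by positivity), ?_, ?_, ?_⟩
  · apply Real.sqrt_lt_sqrt (by positivity)
    apply div_lt_div_of_pos_left hk0 hm (by linarith)
  · rw [← Real.sqrt_div (by positivity)]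
    congr 1; field_simp
  · intro x y hxy
    have hk' : k = (R-d)*(a*(x-sx)+b*(y-sy))^2 + (R+d)*(-b*(x-sx)+a*(y-sy))^2 := by
      rcases hxy with ⟨rfl, rfl⟩ | ⟨rfl, rfl⟩ | ⟨rfl, rfl⟩ <;> assumption
    rw [Real.sq_sqrt (by positivity), Real.sq_sqrt (by positivity), div_div_eq_mul_div,
      div_div_eq_mul_div, ← add_div, div_eq_one_iff_eq hk0.ne', hk']
    ring

theorem ptNorm_half (p : ℝ × ℝ) (l : ℝ) (hl : 0 ≤ l) (h : (2*p.1)^2+(2*p.2)^2 = l^2) :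
    ptNorm p = l/2 := by
  unfold ptNorm
  rw [show p.1^2+p.2^2 = (l/2)^2 by linarith]
  exact Real.sqrt_sq (by positivity)

/-- the circumconic of the poristic triangle centered at the Spieker
center has invariant aspect ratio `√((R+d)/(R−d))`: all three vertices lie on some
ellipse centered at `X₁₀` with semiaxes `η > ζ > 0`, `η/ζ = √((R+d)/(R−d))`,
rotated by some angle `θ`. -/
theorem spieker_circumconic_aspect_ratio
    (R d : ℝ) (hd : 0 < d) (hdR : d < R) (t : ℝ)
    (hnc : ((Pv R d t 1).1 - (Pv R d t 0).1) * ((Pv R d t 2).2 - (Pv R d t 0).2)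
         - ((Pv R d t 1).2 - (Pv R d t 0).2) * ((Pv R d t 2).1 - (Pv R d t 0).1) ≠ 0) :
    ∃ θ η ζ : ℝ, 0 < ζ ∧ ζ < η ∧ η / ζ = Real.sqrt ((R + d) / (R - d)) ∧
      ∀ i : Fin 3,
        (Real.cos θ * ((Pv R d t i).1 - (Spieker R d t).1)
            + Real.sin θ * ((Pv R d t i).2 - (Spieker R d t).2)) ^ 2 / η ^ 2
          + (-Real.sin θ * ((Pv R d t i).1 - (Spieker R d t).1)
              + Real.cos θ * ((Pv R d t i).2 - (Spieker R d t).2)) ^ 2 / ζ ^ 2 = 1 := by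
  have hR : 0 < R := hd.trans hdR
  have hr : 2*R*rIn R d = R^2-d^2 := by unfold rIn; field_simp
  have hcs : Real.sin t ^2 = 1 - Real.cos t^2 := Real.sin_sq t
  have hc1 := Real.cos_le_one t
  have hc2 := Real.neg_one_le_cos t
  have hr0 : 0 < rIn R d := by
    have : 0 < R^2-d^2 := by nlinarith
    unfold rIn; positivity
  have hrR : rIn R d < R - d := by
    have : 2*R*(rIn R d) < 2*R*(R-d) := by nlinarith
    exact lt_of_mul_lt_mul_left this (by positivity)
  have hdc : d * Real.cos t ≤ d := by nlinarith
  have hxy : 0 < R^2-(d*Real.cos t+rIn R d)^2 - (d*Real.sin t)^2 := by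
    have : R^2-(d*Real.cos t+rIn R d)^2 - (d*Real.sin t)^2
       = rIn R d*(2*R-rIn R d-2*(d*Real.cos t)) := by linear_combination (-d^2)*hcs - hr
    rw [this]; apply mul_pos hr0; linarith
  have hw : om R d t^2 = R^2-(d*Real.cos t+rIn R d)^2 := by
    unfold om; apply Real.sq_sqrt; nlinarith [sq_nonneg (d*Real.sin t)]
  have hw0 : 0 ≤ om R d t := Real.sqrt_nonneg _
  obtain ⟨ha, hb⟩ : -om R d t < d * Real.sin t ∧ d * Real.sin t < om R d t := 
    abs_lt.1 (abs_lt_of_sq_lt_sq (by linarith) hw0)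
  obtain ⟨D, hD⟩ : ∃ D, D = R^2-2*d*R*Real.cos t+d^2 := ⟨_, rfl⟩
  have hD0 : 0 < D := by rw [hD]; nlinarith [mul_nonneg hd.le hR.le]
  obtain ⟨X, hX⟩ : ∃ X, X = (2*d*R-(R^2+d^2)*Real.cos t)/D := ⟨_, rfl⟩
  obtain ⟨Y, hY⟩ : ∃ Y, Y = (d^2-R^2)*Real.sin t/D := ⟨_, rfl⟩
  obtain ⟨z, hz⟩ : ∃ z, z = (R^2-d^2)*om R d t/D := ⟨_, rfl⟩
  have hz0 : 0 ≤ z := by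
    rw [hz]; have : 0 < R^2-d^2 := by nlinarith
    positivity
  have hP0 : Pv R d t 0 = (Real.cos t * (d * Real.cos t + rIn R d) - om R d t * Real.sin t + d,
     (d * Real.cos t + rIn R d) * Real.sin t + om R d t * Real.cos t) := rfl
  have hP1 : Pv R d t 1 = (Real.cos t * (d * Real.cos t + rIn R d) + om R d t * Real.sin t + d,
     (d * Real.cos t + rIn R d) * Real.sin t - om R d t * Real.cos t) := rfl
  have hP2 : Pv R d t 2 = (R*X + d, R*Y) := by
    rw [hX, hY, hD]
    change ((_, _) : ℝ × ℝ) = _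
    ext
    · simp only [mul_div_assoc]
    · simp only [mul_div_assoc, mul_assoc]
  have hn : -z = (R^2-d^2)*(-om R d t)/D := by rw [hz]; ring
  have hw' : (-om R d t)^2 = R^2-(d*Real.cos t+rIn R d)^2 := by rw [neg_sq, hw]
  have l13 := len13 R d _ _ _ _ z X Y D hr hcs hw hD hD0.ne' hR.ne' hX hY hz
  have l23 := len13 R d _ _ _ _ (-z) X Y D hr hcs hw' hD hD0.ne' hR.ne' hX hY hn
  have ix := incx R d _ _ _ _ z X Y D hr hcs hw hD hD0.ne' hR.ne' hX hY hz
  have iy := incy R d _ _ _ _ z X Y D hr hcs hw hD hD0.ne' hR.ne' hX hY hz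
  have E12 := e12 R d _ _ X Y D _ _ hcs hD hD0.ne' hX hY rfl rfl
  have E13 := e13 R d _ _ _ _ X Y D _ _ hr hcs hw hD hD0.ne' hR.ne' hX hY rfl rfl _ _ _ _ rfl rfl rfl rfl
  have hXY := xy1 R d _ _ X Y D hcs hD hD0.ne' hX hY
  have n0 : ptNorm (Mv R d t 1 - Mv R d t 2) = (om R d t - d*Real.sin t + z)/2 := by
    apply ptNorm_half _ _ (by linarith)
    simp [Mv, hP0, hP1, hP2]
    linear_combination l23
  have n1 : ptNorm (Mv R d t 0 - Mv R d t 2) = (om R d t + d*Real.sin t + z)/2 := by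
    apply ptNorm_half _ _ (by linarith)
    simp [Mv, hP0, hP1, hP2]
    linear_combination l13
  have n2 : ptNorm (Mv R d t 0 - Mv R d t 1) = (2*om R d t)/2 := by
    apply ptNorm_half _ _ (by linarith)
    simp [Mv, hP0, hP1, hP2]
    linear_combination 4*(om R d t)^2*hcs
  have hT : 0 < 4*om R d t + 2*z := by linarith
  have hsum : (om R d t - d*Real.sin t + z)/2 + (om R d t + d*Real.sin t + z)/2 + (2*om R d t)/2
      = (4*om R d t+2*z)/2 := by ring
  have hsx : (Spieker R d t).1 = ((Pv R d t 0).1+(Pv R d t 1).1+(Pv R d t 2).1-2*d)/2 := by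
    unfold Spieker
    rw [n0, n1, n2, hsum]
    simp [Mv, hP0, hP1, hP2]
    field_simp
    linear_combination (-1)*ix
  have hsy : (Spieker R d t).2 = ((Pv R d t 0).2+(Pv R d t 1).2+(Pv R d t 2).2)/2 := by
    unfold Spieker
    rw [n0, n1, n2, hsum]
    simp [Mv, hP0, hP1, hP2]
    field_simp
    linear_combination (-1)*iy
  obtain ⟨θ, η, ζ, h1, h2, h3, h4⟩ := core R d _ _ _ _ _ _ _ _
    (-((Real.cos t^2-Real.sin t^2)*X-2*Real.cos t*Real.sin t*Y))
    (-((Real.cos t^2-Real.sin t^2)*Y+2*Real.cos t*Real.sin t*X)) hd hdR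
    (by linear_combination (Real.cos t^2+Real.sin t^2)^2*hXY + (Real.cos t^2+Real.sin t^2+1)*hcs)
    hnc hsx hsy
    (by rw [hP0, hP1, hP2]; linear_combination 2*om R d t*E12)
    (by rw [hP0, hP1, hP2]; linear_combination E13)
  refine ⟨θ, η, ζ, h1, h2, h3, fun i => h4 _ _ ?_⟩
  fin_cases i <;> simp
end
end

section
/- For every real t, suppose E₁(t), E₂(t), E₃(t) are points of ℝ² such that for each i ∈ {1, 2, 3}, with {j, k} = {1, 2, 3} \ {i}, the point Eᵢ(t) lies on both lines ℓⱼ'(t) and ℓₖ'(t) (so E₁(t), E₂(t), E₃(t) are the excenters, the vertices of the excentral triangle). Then there exist an angle θ ∈ ℝ and semiaxes η > ζ > 0 with η/ζ = √((R + d)/(R − d)) such that all three excenters Eᵢ(t) lie on the ellipse centered at X₃ = (d, 0) obtained by rotating {(u, v) : u²/η² + v²/ζ² = 1} by θ. (Thus the circumconic of the excentral triangle centered at its nine-point center, which is X₃ of the poristic triangle, has invariant aspect ratio √((R + d)/(R − d)).) -/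
noncomputable section

/-- Polar angle of a unit vector. -/
theorem aux_angle (p q : ℝ) (h : p ^ 2 + q ^ 2 = 1) : ∃ φ : ℝ, Real.cos φ = p ∧ Real.sin φ = q := by
  have hn : ‖(⟨p, q⟩ : ℂ)‖ = 1 := by
    rw [Complex.norm_def, Complex.normSq_mk, Real.sqrt_eq_one]; linarith
  have h0 : (⟨p, q⟩ : ℂ) ≠ 0 := by
    intro h0; rw [h0] at hn; simp at hn
  refine ⟨Complex.arg ⟨p, q⟩, ?_, ?_⟩
  · rw [Complex.cos_arg h0, hn]; simp
  · rw [Complex.sin_arg, hn]; simp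

/-- Solving for the vertex. -/
theorem aux_vertex (R d c s w r N k x y : ℝ) (hd : 0 < d) (hdR : d < R) (hcs : c ^ 2 + s ^ 2 = 1)
    (hr : 2 * R * r = R ^ 2 - d ^ 2) (hw : w ^ 2 = R ^ 2 - (d * c + r) ^ 2)
    (hN : N = R ^ 2 - 2 * d * R * c + d ^ 2) (hN0 : 0 < N) (hk : N * k = 2 * R * w)
    (h1 : ((d * s - w) * s - r * c) * x + (-((d * c + r) * s - w * c)) * y + (R ^ 2 - d ^ 2) = 0)
    (h3 : (R * c - d) * x + (R * s) * y + (-(2 * d * R * c) + R ^ 2 + d ^ 2) = 0) :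
    x = -(R * c - d) + k * (R * s) ∧ y = -(R * s) - k * (R * c - d) := by
  have hR : 0 < R := hd.trans hdR
  have hrpos : 0 < r := by
    have : 0 < 2 * R * r := by rw [hr]; nlinarith
    exact pos_of_mul_pos_right this (by positivity)
  have hc1 : c ≤ 1 := by nlinarith [sq_nonneg s]
  have hNr : N = 2 * R * (R - d * c - r) := by rw [hN]; linarith
  have hm : 0 < R - d * c - r := by
    rw [hNr] at hN0
    exact pos_of_mul_pos_right hN0 (by positivity)
  have hs2 : s ^ 2 = 1 - c ^ 2 := by linarith
  obtain ⟨D, hD⟩ : ∃ D, D = d * s * (R - d * c - r) - w * (R - d * c) := ⟨_, rfl⟩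
  have hDD : D * (d * s * (R - d * c - r) + w * (R - d * c))
      = - ((R - d * c - r) * r * (3 * R ^ 2 + d ^ 2 - 4 * R * (d * c))) := by
    have e : (d ^ 2 - (d * c) ^ 2) * (R - d * c - r) - (R + d * c + r) * (R - d * c) ^ 2
        = - (r * (3 * R ^ 2 + d ^ 2 - 4 * R * (d * c))) := by
      linear_combination (R - d * c) * hr
    have : D * (d * s * (R - d * c - r) + w * (R - d * c))
        = d ^ 2 * s ^ 2 * (R - d * c - r) ^ 2 - w ^ 2 * (R - d * c) ^ 2 := by rw [hD]; ring
    rw [this, hs2, hw]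
    linear_combination (R - d * c - r) * e
  have hD0 : D ≠ 0 := by
    intro h
    rw [h, zero_mul] at hDD
    have h4 : 0 < 3 * R ^ 2 + d ^ 2 - 4 * R * (d * c) := by
      have : R * d * c ≤ R * d * 1 := mul_le_mul_of_nonneg_left hc1 (by positivity)
      nlinarith
    have : 0 < (R - d * c - r) * r * (3 * R ^ 2 + d ^ 2 - 4 * R * (d * c)) := by positivity
    linarith
  have hdet : ((d * s - w) * s - r * c) * (R * s) - (-((d * c + r) * s - w * c)) * (R * c - d) = D := by
    rw [hD]
    linear_combination (d * s * R - w * R) * hcs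
  have hx0 : ((d * s - w) * s - r * c) * (-(R * c - d) + k * (R * s)) +
      (-((d * c + r) * s - w * c)) * (-(R * s) - k * (R * c - d)) + (R ^ 2 - d ^ 2) = 0 := by
    have e1 : ((d * s - w) * s - r * c) * (R * c - d) + (-((d * c + r) * s - w * c)) * (R * s)
        = -(d * s - w) * d * s - r * (R - d * c) := by
      linear_combination (-r * R) * hcs
    have e2 : (d * s - w) * d * s + r * (R - d * c) + k * D + (R ^ 2 - d ^ 2) = 0 := by
      have : N * ((d * s - w) * d * s + r * (R - d * c) + k * D + (R ^ 2 - d ^ 2)) = 0 := by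
        have : N * ((d * s - w) * d * s + r * (R - d * c) + k * D + (R ^ 2 - d ^ 2))
          = N * (d ^ 2 * s ^ 2 - w * d * s + r * (R - d * c) + (R ^ 2 - d ^ 2)) + (N * k) * D := by ring
        rw [this, hk, hD, hs2, hNr]
        linear_combination (-2 * R * (R - d * c)) * hw
      rcases mul_eq_zero.1 this with h | h
      · exact absurd h hN0.ne'
      · exact h
    linear_combination e2 - e1 + k * hdet
  have hy0 : (R * c - d) * (-(R * c - d) + k * (R * s)) + (R * s) * (-(R * s) - k * (R * c - d))
      + (-(2 * d * R * c) + R ^ 2 + d ^ 2) = 0 := by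
    linear_combination (-R ^ 2) * hcs
  constructor
  · have : D * (x - (-(R * c - d) + k * (R * s))) = 0 := by
      rw [← hdet]
      linear_combination (R * s) * (h1 - hx0) - (-((d * c + r) * s - w * c)) * (h3 - hy0)
    rcases mul_eq_zero.1 this with h | h
    · exact absurd h hD0
    · linarith
  · have : D * (y - (-(R * s) - k * (R * c - d))) = 0 := by
      rw [← hdet]
      linear_combination ((d * s - w) * s - r * c) * (h3 - hy0) - (R * c - d) * (h1 - hx0)
    rcases mul_eq_zero.1 this with h | h
    · exact absurd h hD0
    · linarith

theorem aux_conic (R d c s N k pc ps x y : ℝ) (hcs : c ^ 2 + s ^ 2 = 1)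
    (hN : N = R ^ 2 - 2 * d * R * c + d ^ 2) (hN0 : 0 < N)
    (hk : N * k ^ 2 = 4 * R ^ 2 - N)
    (hpc : N * pc = -(c * ((R * c - d) ^ 2 - (R * s) ^ 2) - 2 * s * (R * c - d) * (R * s)))
    (hps : N * ps = -(s * ((R * c - d) ^ 2 - (R * s) ^ 2) + 2 * c * (R * c - d) * (R * s)))
    (hx : x = -(R * c - d) + k * (R * s)) (hy : y = -(R * s) - k * (R * c - d)) :
    R * ((x - d) ^ 2 + y ^ 2) - d * (pc * ((x - d) ^ 2 - y ^ 2) + 2 * ps * (x - d) * y)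
      = 4 * R ^ 3 - 3 * d ^ 2 * R - d ^ 3 * pc := by
  have hs2 : s ^ 2 = 1 - c ^ 2 := by linarith
  have : N * (R * ((x - d) ^ 2 + y ^ 2) - d * (pc * ((x - d) ^ 2 - y ^ 2) + 2 * ps * (x - d) * y)
      - (4 * R ^ 3 - 3 * d ^ 2 * R - d ^ 3 * pc)) = 0 := by
    have hNn : (R * c - d) ^ 2 + (R * s) ^ 2 = N := by
      rw [hN]; linear_combination R ^ 2 * hcs
    obtain ⟨V, hV⟩ : ∃ V, V = N * k - d * R * s := ⟨_, rfl⟩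
    have e1 : (R * c - d) * (x - d) + (R * s) * y = -(R * (R - d * c)) := by
      rw [hx, hy]; linear_combination (-R ^ 2) * hcs
    have e2 : (R * c - d) * y - (R * s) * (x - d) = -V := by
      rw [hx, hy, hV, ← hNn]; ring
    have e3 : N * ((x - d) ^ 2 + y ^ 2) = (R * (R - d * c)) ^ 2 + V ^ 2 := by
      have : N * ((x - d) ^ 2 + y ^ 2) = ((R * c - d) * (x - d) + (R * s) * y) ^ 2
        + ((R * c - d) * y - (R * s) * (x - d)) ^ 2 := by rw [← hNn]; ring
      rw [this, e1, e2]; ring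
    have e4 : N * (pc * ((x - d) ^ 2 - y ^ 2) + 2 * ps * (x - d) * y)
        = -(c * ((R * (R - d * c)) ^ 2 - V ^ 2) + 2 * s * (R * (R - d * c)) * V) := by
      have : N * (pc * ((x - d) ^ 2 - y ^ 2) + 2 * ps * (x - d) * y)
        = -(c * (((R * c - d) * (x - d) + (R * s) * y) ^ 2
          - ((R * c - d) * y - (R * s) * (x - d)) ^ 2)
          + 2 * s * ((R * c - d) * (x - d) + (R * s) * y) *
            ((R * c - d) * y - (R * s) * (x - d))) := by
        linear_combination ((x - d) ^ 2 - y ^ 2) * hpc + 2 * (x - d) * y * hps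
      rw [this, e1, e2]; ring
    have e5 : V ^ 2 = N * (4 * R ^ 2 - N) - 2 * d * R * s * (N * k) + d ^ 2 * R ^ 2 * (1 - c ^ 2) := by
      rw [hV]; linear_combination N * hk + d ^ 2 * R ^ 2 * hs2
    have e6 : N * pc = -(c * ((R * c - d) ^ 2 - R ^ 2 * (1 - c ^ 2))
        - 2 * (1 - c ^ 2) * (R * c - d) * R) := by
      rw [hpc]; linear_combination (c * R ^ 2 + 2 * (R * c - d) * R) * hs2
    have e7 : s * V = s * (N * k) - d * R * (1 - c ^ 2) := by
      rw [hV]; linear_combination (-d * R) * hs2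
    rw [hN] at e5 e6 e7 e3 e4 ⊢
    linear_combination R * e3 - d * e4 + d ^ 3 * e6 + (R - d * c) * e5
      + 2 * d * (R * (R - d * c)) * e7
  rcases mul_eq_zero.1 this with h | h
  · exact absurd h hN0.ne'
  · linarith

theorem aux_conic3 (R d c s N pc ps x y : ℝ) (hcs : c ^ 2 + s ^ 2 = 1)
    (hN : N = R ^ 2 - 2 * d * R * c + d ^ 2) (hN0 : 0 < N)
    (hpc : N * pc = -(c * ((R * c - d) ^ 2 - (R * s) ^ 2) - 2 * s * (R * c - d) * (R * s)))
    (hps : N * ps = -(s * ((R * c - d) ^ 2 - (R * s) ^ 2) + 2 * c * (R * c - d) * (R * s)))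
    (hx : x = 2 * R * c) (hy : y = 2 * R * s) :
    R * ((x - d) ^ 2 + y ^ 2) - d * (pc * ((x - d) ^ 2 - y ^ 2) + 2 * ps * (x - d) * y)
      = 4 * R ^ 3 - 3 * d ^ 2 * R - d ^ 3 * pc := by
  have : N * (R * ((x - d) ^ 2 + y ^ 2) - d * (pc * ((x - d) ^ 2 - y ^ 2) + 2 * ps * (x - d) * y)
      - (4 * R ^ 3 - 3 * d ^ 2 * R - d ^ 3 * pc)) = 0 := by
    grind
  rcases mul_eq_zero.1 this with h | h
  · exact absurd h hN0.ne'
  · linarith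

/-- the circumconic of the excentral triangle centered at `X₃ = (d,0)`
has invariant aspect ratio `√((R+d)/(R−d))`: if `E i` lies on both excentral
sidelines `ℓⱼ'(t)` with `j ≠ i` (so the `E i` are the excenters), then all three
excenters lie on some ellipse centered at `(d,0)` with semiaxes `η > ζ > 0`,
`η/ζ = √((R+d)/(R−d))`, rotated by some angle `θ`. -/
theorem excentral_circumconic_aspect_ratio
    (R d : ℝ) (hd : 0 < d) (hdR : d < R) (t : ℝ)
    (E : Fin 3 → ℝ × ℝ)
    (hE : ∀ i j : Fin 3, j ≠ i →
      lineA R d t j * (E i).1 + lineB R d t j * (E i).2 + lineC R d t j = 0) :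
    ∃ θ η ζ : ℝ, 0 < ζ ∧ ζ < η ∧ η / ζ = Real.sqrt ((R + d) / (R - d)) ∧
      ∀ i : Fin 3,
        (Real.cos θ * ((E i).1 - d) + Real.sin θ * (E i).2) ^ 2 / η ^ 2
          + (-Real.sin θ * ((E i).1 - d) + Real.cos θ * (E i).2) ^ 2 / ζ ^ 2 = 1 := by
  have hR : 0 < R := hd.trans hdR
  have hcs : Real.cos t ^ 2 + Real.sin t ^ 2 = 1 := Real.cos_sq_add_sin_sq t
  have hr : 2 * R * rIn R d = R ^ 2 - d ^ 2 := by
    unfold rIn; field_simp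
  have hc1 : Real.cos t ≤ 1 := Real.cos_le_one t
  have hc2 : -1 ≤ Real.cos t := Real.neg_one_le_cos t
  have hrpos : 0 < rIn R d := by
    have : 0 < 2 * R * rIn R d := by rw [hr]; nlinarith
    exact pos_of_mul_pos_right this (by positivity)
  have hrlt : rIn R d < R - d := by
    have : 2 * R * rIn R d < 2 * R * (R - d) := by rw [hr]; nlinarith
    exact lt_of_mul_lt_mul_left this (by positivity)
  have hdc1 : d * Real.cos t ≤ d := by nlinarith
  have hdc2 : -d ≤ d * Real.cos t := by nlinarith
  have hrad : 0 < R ^ 2 - (d * Real.cos t + rIn R d) ^ 2 := by nlinarith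
  have hw : om R d t ^ 2 = R ^ 2 - (d * Real.cos t + rIn R d) ^ 2 := Real.sq_sqrt hrad.le
  have hwpos : 0 < om R d t := Real.sqrt_pos.2 hrad
  have h01 := hE 0 1 (by decide)
  have h02 := hE 0 2 (by decide)
  have h10 := hE 1 0 (by decide)
  have h12 := hE 1 2 (by decide)
  have h20 := hE 2 0 (by decide)
  have h21 := hE 2 1 (by decide)
  simp only [lineA, lineB, lineC, Matrix.cons_val_zero, Matrix.cons_val_one, Matrix.cons_val]
    at h01 h02 h10 h12 h20 h21
  clear hE
  generalize om R d t = w at *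
  generalize rIn R d = r at *
  generalize Real.cos t = c at *
  generalize Real.sin t = s at *
  obtain ⟨N, hN⟩ : ∃ N, N = R ^ 2 - 2 * d * R * c + d ^ 2 := ⟨_, rfl⟩
  have hN0 : 0 < N := by
    rw [hN]; nlinarith [mul_le_mul_of_nonneg_left hdc1 hR.le, mul_pos (sub_pos.2 hdR) (sub_pos.2 hdR)]
  obtain ⟨k, hk⟩ : ∃ k, N * k = 2 * R * w := ⟨2 * R * w / N, by field_simp⟩
  have hk2 : N * k ^ 2 = 4 * R ^ 2 - N := by
    have h : N * (N * k ^ 2 - (4 * R ^ 2 - N)) = 0 := by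
      have : N * (N * k ^ 2 - (4 * R ^ 2 - N)) = (N * k) ^ 2 - N * (4 * R ^ 2 - N) := by ring
      rw [this, hk]
      have hNr : N = 2 * R * (R - d * c - r) := by rw [hN]; linarith
      have : 4 * R ^ 2 - N = 2 * R * (R + d * c + r) := by rw [hNr]; ring
      rw [this, hNr]
      linear_combination 4 * R ^ 2 * hw
    rcases mul_eq_zero.1 h with h | h
    · exact absurd h hN0.ne'
    · linarith
  obtain ⟨pc, hpc⟩ : ∃ pc, N * pc =
      -(c * ((R * c - d) ^ 2 - (R * s) ^ 2) - 2 * s * (R * c - d) * (R * s)) :=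
    ⟨_ / N, mul_div_cancel₀ _ hN0.ne'⟩
  obtain ⟨ps, hps⟩ : ∃ ps, N * ps =
      -(s * ((R * c - d) ^ 2 - (R * s) ^ 2) + 2 * c * (R * c - d) * (R * s)) :=
    ⟨_ / N, mul_div_cancel₀ _ hN0.ne'⟩
  have hpp : pc ^ 2 + ps ^ 2 = 1 := by
    have hNn : (R * c - d) ^ 2 + (R * s) ^ 2 = N := by
      rw [hN]; linear_combination R ^ 2 * hcs
    have h : N ^ 2 * (pc ^ 2 + ps ^ 2) = N ^ 2 * 1 := by
      have : N ^ 2 * (pc ^ 2 + ps ^ 2) = (N * pc) ^ 2 + (N * ps) ^ 2 := by ring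
      rw [this, hpc, hps, ← hNn]
      linear_combination ((R * c - d) ^ 2 + (R * s) ^ 2) ^ 2 * hcs
    exact mul_left_cancel₀ (by positivity) h
  obtain ⟨e0x, e0y⟩ := aux_vertex R d c s (-w) r N (-k) (E 0).1 (E 0).2 hd hdR hcs hr
    (by rw [neg_sq]; exact hw) hN hN0 (by linear_combination -hk)
    (by linear_combination h01) h02
  obtain ⟨e1x, e1y⟩ := aux_vertex R d c s w r N k (E 1).1 (E 1).2 hd hdR hcs hr
    hw hN hN0 hk h10 h12
  have hq : s * (E 2).1 - c * (E 2).2 = 0 := by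
    have : w * (s * (E 2).1 - c * (E 2).2) = 0 := by linear_combination (h21 - h20) / 2
    exact (mul_eq_zero.1 this).resolve_left hwpos.ne'
  have hp : c * (E 2).1 + s * (E 2).2 = 2 * R := by
    have : r * (c * (E 2).1 + s * (E 2).2 - 2 * R) = 0 := by
      linear_combination (-1/2) * (h20 + h21) + d * s * hq - hr
    have := (mul_eq_zero.1 this).resolve_left hrpos.ne'
    linarith
  have e2x : (E 2).1 = 2 * R * c := by
    linear_combination c * hp + s * hq - (E 2).1 * hcs
  have e2y : (E 2).2 = 2 * R * s := by
    linear_combination s * hp - c * hq - (E 2).2 * hcs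
  have key : ∀ i : Fin 3, R * (((E i).1 - d) ^ 2 + (E i).2 ^ 2) -
      d * (pc * (((E i).1 - d) ^ 2 - (E i).2 ^ 2) + 2 * ps * ((E i).1 - d) * (E i).2)
      = 4 * R ^ 3 - 3 * d ^ 2 * R - d ^ 3 * pc := by
    intro i
    fin_cases i
    · exact aux_conic R d c s N (-k) pc ps _ _ hcs hN hN0 (by rw [neg_sq]; exact hk2) hpc hps e0x e0y
    · exact aux_conic R d c s N k pc ps _ _ hcs hN hN0 hk2 hpc hps e1x e1y
    · exact aux_conic3 R d c s N pc ps _ _ hcs hN hN0 hpc hps e2x e2y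
  obtain ⟨φ, hφc, hφs⟩ := aux_angle pc ps hpp
  have hpc1 : pc ≤ 1 := by rw [← hφc]; exact Real.cos_le_one φ
  obtain ⟨K, hK⟩ : ∃ K, K = 4 * R ^ 3 - 3 * d ^ 2 * R - d ^ 3 * pc := ⟨_, rfl⟩
  have hK0 : 0 < K := by
    have h1 : d ^ 3 * pc ≤ d ^ 3 * 1 := mul_le_mul_of_nonneg_left hpc1 (by positivity)
    have h2 : d ^ 3 < R ^ 3 := pow_lt_pow_left₀ hdR hd.le (by norm_num)
    have h3 : d ^ 2 * R < R ^ 3 := by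
      have : d ^ 2 < R ^ 2 := pow_lt_pow_left₀ hdR hd.le (by norm_num)
      have := mul_lt_mul_of_pos_right this hR
      linarith [pow_succ R 2]
    linarith
  have hm : 0 < R - d := sub_pos.2 hdR
  have hpl : 0 < R + d := by linarith
  have c2 : 2 * Real.cos (φ / 2) ^ 2 - 1 = pc := by
    rw [← hφc, ← Real.cos_two_mul]; congr 1; ring
  have s2 : 2 * Real.sin (φ / 2) * Real.cos (φ / 2) = ps := by
    rw [← hφs, ← Real.sin_two_mul]; congr 1; ring
  have cs2 := Real.cos_sq_add_sin_sq (φ / 2)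
  refine ⟨φ / 2, Real.sqrt (K / (R - d)), Real.sqrt (K / (R + d)), Real.sqrt_pos.2 (by positivity),
    Real.sqrt_lt_sqrt (by positivity) (div_lt_div_of_pos_left hK0 hm (by linarith)), ?_, ?_⟩
  · rw [← Real.sqrt_div (by positivity)]
    congr 1
    field_simp
  · intro i
    have := key i
    rw [Real.sq_sqrt (by positivity), Real.sq_sqrt (by positivity)]
    rw [← hK, ← c2, ← s2] at this
    generalize Real.cos (φ / 2) = C at *
    generalize Real.sin (φ / 2) = S at *
    generalize (E i).1 - d = x at *
    generalize (E i).2 = y at *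
    have h2 : (C * x + S * y) ^ 2 * (R - d) + (-S * x + C * y) ^ 2 * (R + d) = K := by
      rw [← this]
      linear_combination (R * (x ^ 2 + y ^ 2) + d * (x ^ 2 - y ^ 2)) * cs2
    rw [div_div_eq_mul_div, div_div_eq_mul_div, ← add_div, h2, div_self hK0.ne']
end
end
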